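/- Let F be a field with at least 3 elements, n = 4 and k = 2. Let Γ'_t be the simple graph whose vertices are the non-degenerate 2-dimensional subspaces of F^4 together with the linear maximal cliques of Δ'_t, with edges as follows: two non-degenerate 2-dimensional subspaces are joined by an edge if and only if they are adjacent; a non-degenerate 2-dimensional subspace A and a linear maximal clique 𝔗 are joined by an edge if and only if A belongs to some top in 𝔗; two distinct linear maximal cliques 𝔗_1, 𝔗_2 are joined by an edge if and only if there exists a star of Δ_2(V) having non-empty intersection with every top belonging to 𝔗_1 and with every top belonging to 𝔗_2. Then the map sending each non-degenerate 2-dimensional subspace to itself and each linear maximal clique 𝔗_X to the degenerate 2-dimensional subspace X is a graph isomorphism from Γ'_t onto the Grassmann graph Γ_2(F^4). -/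

import Mathlib

open Module

section Defs

variable (F : Type*) [Field F]

/-- The `i`-th coordinate hyperplane in `F^n`: the kernel of the `i`-th coordinate functional. -/
def coordHyp (n : ℕ) (i : Fin n) : Submodule F (Fin n → F) :=
  LinearMap.ker (LinearMap.proj (R := F) (φ := fun _ : Fin n => F) i)

/-- A subspace of `F^n` is degenerate if it is contained in some coordinate hyperplane. -/
def IsDeg (n : ℕ) (W : Submodule F (Fin n → F)) : Prop :=
  ∃ i : Fin n, W ≤ coordHyp F n i

/-- A subspace of `F^n` is non-degenerate if it is not degenerate. -/
def IsNondeg (n : ℕ) (W : Submodule F (Fin n → F)) : Prop :=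
  ¬ IsDeg F n W

/-- Adjacency of `k`-dimensional subspaces: distinct with `(k-1)`-dimensional intersection. -/
def AdjK (n k : ℕ) (A B : Submodule F (Fin n → F)) : Prop :=
  A ≠ B ∧ finrank F ↥(A ⊓ B) = k - 1

/-- The star `S(X)`: all `k`-dimensional subspaces containing `X`. -/
def Sstar (n k : ℕ) (X : Submodule F (Fin n → F)) : Set (Submodule F (Fin n → F)) :=
  {A | finrank F ↥A = k ∧ X ≤ A}

/-- `S^c(X)`: all non-degenerate `k`-dimensional subspaces containing `X`. -/
def Sc (n k : ℕ) (X : Submodule F (Fin n → F)) : Set (Submodule F (Fin n → F)) :=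
  {A | finrank F ↥A = k ∧ X ≤ A ∧ IsNondeg F n A}

/-- `T^c(Y)`: all non-degenerate `k`-dimensional subspaces contained in `Y`. -/
def Tc (n k : ℕ) (Y : Submodule F (Fin n → F)) : Set (Submodule F (Fin n → F)) :=
  {A | finrank F ↥A = k ∧ A ≤ Y ∧ IsNondeg F n A}

/-- A clique of `Δ_k(V)`: a set of non-degenerate `k`-dimensional subspaces which are
pairwise adjacent. -/
def IsCliqueD (n k : ℕ) (C : Set (Submodule F (Fin n → F))) : Prop :=
  (∀ A ∈ C, finrank F ↥A = k ∧ IsNondeg F n A) ∧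
    ∀ A ∈ C, ∀ B ∈ C, A ≠ B → AdjK F n k A B

/-- A maximal clique of `Δ_k(V)`. -/
def IsMaxCliqueD (n k : ℕ) (C : Set (Submodule F (Fin n → F))) : Prop :=
  IsCliqueD F n k C ∧ ∀ D, IsCliqueD F n k D → C ⊆ D → D = C

/-- A star of `Δ_k(V)`: a set `S^c(X)` which is a maximal clique of `Δ_k(V)`. -/
def IsStarD (n k : ℕ) (S : Set (Submodule F (Fin n → F))) : Prop :=
  (∃ X : Submodule F (Fin n → F), finrank F ↥X = k - 1 ∧ S = Sc F n k X) ∧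
    IsMaxCliqueD F n k S

/-- A top of `Δ_k(V)`: a set `T^c(Y)` which is a maximal clique of `Δ_k(V)`. -/
def IsTopD (n k : ℕ) (T : Set (Submodule F (Fin n → F))) : Prop :=
  (∃ Y : Submodule F (Fin n → F), finrank F ↥Y = k + 1 ∧ T = Tc F n k Y) ∧
    IsMaxCliqueD F n k T

/-- Adjacency of maximal cliques used in the graphs `Δ_s` and `Δ_t`:
two distinct cliques such that every vertex of each is adjacent to some vertex of the other. -/
def AdjMC (n k : ℕ) (C1 C2 : Set (Submodule F (Fin n → F))) : Prop :=
  C1 ≠ C2 ∧ (∀ A ∈ C1, ∃ B ∈ C2, AdjK F n k A B) ∧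
    (∀ A ∈ C2, ∃ B ∈ C1, AdjK F n k A B)

/-- Adjacency in the graphs `Δ'_s` and `Δ'_t`: adjacent as above with empty intersection. -/
def AdjMC' (n k : ℕ) (C1 C2 : Set (Submodule F (Fin n → F))) : Prop :=
  AdjMC F n k C1 C2 ∧ C1 ∩ C2 = ∅

/-- A clique of the graph `Δ_s` (whose vertices are the stars of `Δ_k(V)`). -/
def IsCliqueDs (n k : ℕ) (𝔖 : Set (Set (Submodule F (Fin n → F)))) : Prop :=
  (∀ S ∈ 𝔖, IsStarD F n k S) ∧ ∀ S ∈ 𝔖, ∀ S' ∈ 𝔖, S ≠ S' → AdjMC F n k S S'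

/-- A maximal clique of `Δ_s`. -/
def IsMaxCliqueDs (n k : ℕ) (𝔖 : Set (Set (Submodule F (Fin n → F)))) : Prop :=
  IsCliqueDs F n k 𝔖 ∧ ∀ 𝔖', IsCliqueDs F n k 𝔖' → 𝔖 ⊆ 𝔖' → 𝔖' = 𝔖

/-- A clique of the graph `Δ'_s`. -/
def IsCliqueDs' (n k : ℕ) (𝔖 : Set (Set (Submodule F (Fin n → F)))) : Prop :=
  (∀ S ∈ 𝔖, IsStarD F n k S) ∧ ∀ S ∈ 𝔖, ∀ S' ∈ 𝔖, S ≠ S' → AdjMC' F n k S S'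

/-- A maximal clique of `Δ'_s`. -/
def IsMaxCliqueDs' (n k : ℕ) (𝔖 : Set (Set (Submodule F (Fin n → F)))) : Prop :=
  IsCliqueDs' F n k 𝔖 ∧ ∀ 𝔖', IsCliqueDs' F n k 𝔖' → 𝔖 ⊆ 𝔖' → 𝔖' = 𝔖

/-- A special set of stars: a maximal clique in both `Δ_s` and `Δ'_s`. -/
def IsSpecialStars (n k : ℕ) (𝔖 : Set (Set (Submodule F (Fin n → F)))) : Prop :=
  IsMaxCliqueDs F n k 𝔖 ∧ IsMaxCliqueDs' F n k 𝔖

/-- A clique of the graph `Δ_t` (whose vertices are the tops of `Δ_k(V)`). -/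
def IsCliqueDt (n k : ℕ) (𝔗 : Set (Set (Submodule F (Fin n → F)))) : Prop :=
  (∀ T ∈ 𝔗, IsTopD F n k T) ∧ ∀ T ∈ 𝔗, ∀ T' ∈ 𝔗, T ≠ T' → AdjMC F n k T T'

/-- A maximal clique of `Δ_t`. -/
def IsMaxCliqueDt (n k : ℕ) (𝔗 : Set (Set (Submodule F (Fin n → F)))) : Prop :=
  IsCliqueDt F n k 𝔗 ∧ ∀ 𝔗', IsCliqueDt F n k 𝔗' → 𝔗 ⊆ 𝔗' → 𝔗' = 𝔗

/-- A clique of the graph `Δ'_t`. -/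
def IsCliqueDt' (n k : ℕ) (𝔗 : Set (Set (Submodule F (Fin n → F)))) : Prop :=
  (∀ T ∈ 𝔗, IsTopD F n k T) ∧ ∀ T ∈ 𝔗, ∀ T' ∈ 𝔗, T ≠ T' → AdjMC' F n k T T'

/-- A maximal clique of `Δ'_t`. -/
def IsMaxCliqueDt' (n k : ℕ) (𝔗 : Set (Set (Submodule F (Fin n → F)))) : Prop :=
  IsCliqueDt' F n k 𝔗 ∧ ∀ 𝔗', IsCliqueDt' F n k 𝔗' → 𝔗 ⊆ 𝔗' → 𝔗' = 𝔗

/-- A special set of tops: a maximal clique in both `Δ_t` and `Δ'_t`. -/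
def IsSpecialTops (n k : ℕ) (𝔗 : Set (Set (Submodule F (Fin n → F)))) : Prop :=
  IsMaxCliqueDt F n k 𝔗 ∧ IsMaxCliqueDt' F n k 𝔗

/-- `𝔗_X`: the set of all `T^c(Y)` over non-degenerate `(k+1)`-dimensional `Y` containing `X`. -/
def TopsThrough (n k : ℕ) (X : Submodule F (Fin n → F)) :
    Set (Set (Submodule F (Fin n → F))) :=
  {T | ∃ Y : Submodule F (Fin n → F),
    finrank F ↥Y = k + 1 ∧ IsNondeg F n Y ∧ X ≤ Y ∧ T = Tc F n k Y}

end Defs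
/-- The Grassmann graph `Γ_k(V)`: vertices are the `k`-dimensional subspaces of `F^n`,
two distinct ones being adjacent when their intersection is `(k-1)`-dimensional. -/
def GrassmannGraph (F : Type*) [Field F] (n k : ℕ) :
    SimpleGraph {A : Submodule F (Fin n → F) // finrank F ↥A = k} :=
  SimpleGraph.fromRel fun A B => finrank F ↥(A.1 ⊓ B.1) = k - 1

/-- A linear maximal clique of `Δ'_t` (for `n = 4`, `k = 2`): a maximal clique of the form
`𝔗_X` for a degenerate `2`-dimensional subspace `X`. -/
def IsLinMC (F : Type*) [Field F] (𝒳 : Set (Set (Submodule F (Fin 4 → F)))) : Prop :=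
  IsMaxCliqueDt' F 4 2 𝒳 ∧
    ∃ X : Submodule F (Fin 4 → F), finrank F ↥X = 2 ∧ IsDeg F 4 X ∧
      𝒳 = TopsThrough F 4 2 X

/-- The graph `Γ'_t`: vertices are the non-degenerate `2`-dimensional subspaces of `F^4`
together with the linear maximal cliques of `Δ'_t`; a subspace is joined to a linear maximal
clique iff it belongs to some top of that clique; two linear maximal cliques are joined iff
some star of `Δ_2(V)` meets every top of both cliques. -/
def GammaT' (F : Type*) [Field F] :
    SimpleGraph
      ({A : Submodule F (Fin 4 → F) // finrank F ↥A = 2 ∧ IsNondeg F 4 A} ⊕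
        {𝒳 : Set (Set (Submodule F (Fin 4 → F))) // IsLinMC F 𝒳}) :=
  SimpleGraph.fromRel fun v w =>
    match v, w with
    | Sum.inl A, Sum.inl B => AdjK F 4 2 A.1 B.1
    | Sum.inl A, Sum.inr 𝒳 => ∃ T ∈ 𝒳.1, A.1 ∈ T
    | Sum.inr 𝒳, Sum.inl A => ∃ T ∈ 𝒳.1, A.1 ∈ T
    | Sum.inr 𝒳1, Sum.inr 𝒳2 =>
        ∃ S, IsStarD F 4 2 S ∧ (∀ T ∈ 𝒳1.1, (S ∩ T).Nonempty) ∧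
          (∀ T ∈ 𝒳2.1, (S ∩ T).Nonempty)

section LinearAlgebra

variable {K V : Type*} [Field K] [AddCommGroup V] [Module K V]

theorem finrank_span_singleton_le_one (v : V) : finrank K (Submodule.span K {v}) ≤ 1 := by
  simpa using finrank_span_le_card (R := K) ({v} : Set V)

variable [FiniteDimensional K V]

theorem finrank_inf_lt_of_ne {A B : Submodule K V} (h : finrank K A = finrank K B)
    (hne : A ≠ B) : finrank K ↥(A ⊓ B) < finrank K A := by
  refine lt_of_le_of_ne (Submodule.finrank_mono inf_le_left) fun h' => hne ?_
  have hAB : A ≤ B := inf_eq_left.1 (Submodule.eq_of_le_of_finrank_eq inf_le_left h')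
  exact Submodule.eq_of_le_of_finrank_eq hAB h

theorem finrank_inf_eq_one_of_le {A B Y : Submodule K V} (hA : finrank K A = 2)
    (hB : finrank K B = 2) (hY : finrank K Y = 3) (hAY : A ≤ Y) (hBY : B ≤ Y) (hne : A ≠ B) :
    finrank K ↥(A ⊓ B) = 1 := by
  have h1 := Submodule.finrank_sup_add_finrank_inf_eq A B
  have h2 := Submodule.finrank_mono (sup_le hAY hBY)
  have h3 := finrank_inf_lt_of_ne (hA.trans hB.symm) hne
  lia

theorem finrank_inf_eq_one_of_ge {A B Z : Submodule K V} (hA : finrank K A = 2)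
    (hB : finrank K B = 2) (hZ : finrank K Z = 1) (hZA : Z ≤ A) (hZB : Z ≤ B) (hne : A ≠ B) :
    finrank K ↥(A ⊓ B) = 1 := by
  have h1 := Submodule.finrank_mono (le_inf hZA hZB)
  have h2 := finrank_inf_lt_of_ne (hA.trans hB.symm) hne
  lia

theorem finrank_sup_eq_three {A B : Submodule K V} (hA : finrank K A = 2)
    (hB : finrank K B = 2) (hAB : finrank K ↥(A ⊓ B) = 1) : finrank K ↥(A ⊔ B) = 3 := by
  have := Submodule.finrank_sup_add_finrank_inf_eq A B
  lia

theorem finrank_inf_eq_one_of_not_le (hV : finrank K V = 4) {A Y : Submodule K V}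
    (hA : finrank K A = 2) (hY : finrank K Y = 3) (h : ¬A ≤ Y) : finrank K ↥(A ⊓ Y) = 1 := by
  have h1 := Submodule.finrank_sup_add_finrank_inf_eq A Y
  have h2 := Submodule.finrank_le (A ⊔ Y)
  have h3 : finrank K ↥(A ⊓ Y) < finrank K A := Submodule.finrank_lt_finrank_of_lt
    (lt_of_le_of_ne inf_le_left fun h' => h (inf_eq_left.1 h'))
  lia

theorem finrank_inf_eq_two (hV : finrank K V = 4) {Y Y' : Submodule K V}
    (hY : finrank K Y = 3) (hY' : finrank K Y' = 3) (h : Y ≠ Y') :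
    finrank K ↥(Y ⊓ Y') = 2 := by
  have h1 := Submodule.finrank_sup_add_finrank_inf_eq Y Y'
  have h2 := Submodule.finrank_le (Y ⊔ Y')
  have h3 := finrank_inf_lt_of_ne (hY.trans hY'.symm) h
  lia

theorem exists_mem_notMem_of_finrank_lt {A B : Submodule K V} (h : finrank K A < finrank K B) :
    ∃ v ∈ B, v ∉ A := by
  by_contra! h'
  exact absurd (Submodule.finrank_mono (show B ≤ A from h')) (by lia)

theorem exists_ne_zero_eq_span {Z : Submodule K V} (hZ : finrank K Z = 1) :
    ∃ z, z ≠ 0 ∧ Z = Submodule.span K {z} := by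
  obtain ⟨z, hz, hz0⟩ := exists_mem_notMem_of_finrank_lt (A := ⊥) (B := Z) (by simp [hZ])
  refine ⟨z, hz0, (Submodule.eq_of_le_of_finrank_eq ?_ ?_).symm⟩
  · simpa using hz
  · rw [finrank_span_singleton hz0, hZ]

end LinearAlgebra

section Nondegenerate

variable {F : Type*} [Field F] {n : ℕ}

theorem isNondeg_iff {W : Submodule F (Fin n → F)} :
    IsNondeg F n W ↔ ∀ i, ∃ v ∈ W, v i ≠ 0 := by
  simp [IsNondeg, IsDeg, coordHyp, SetLike.not_le_iff_exists]

theorem IsNondeg.mono {W W' : Submodule F (Fin n → F)} (h : IsNondeg F n W) (hle : W ≤ W') :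
    IsNondeg F n W' :=
  fun ⟨i, hi⟩ => h ⟨i, hle.trans hi⟩

theorem exists_notMem_forall_ne_zero (hF : (3 : Cardinal) ≤ Cardinal.mk F)
    {W : Submodule F (Fin n → F)} (hW : W ≠ ⊤) : ∃ v ∉ W, ∀ i, v i ≠ 0 := by
  by_contra! h
  have h1 : ∀ v : Fin n → F, (∀ i, v i ≠ 0) → v ∈ W := fun v hv => by
    by_contra hvW
    obtain ⟨i, hi⟩ := h v hvW
    exact hv i hi
  obtain ⟨a, ha0, ha1⟩ := Cardinal.exists_ne_ne_of_three_le hF 0 1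
  refine hW (eq_top_iff.2 fun v _ => ?_)
  rw [pi_eq_sum_univ' v]
  refine W.sum_mem fun i _ => W.smul_mem _ ?_
  have h2 := h1 1 fun _ => one_ne_zero
  have h3 := h1 (Function.update 1 i a) fun j => by
    by_cases hj : j = i
    · subst hj; simpa
    · simp [hj]
  have h4 := W.smul_mem (a - 1)⁻¹ (W.sub_mem h3 h2)
  convert h4 using 1
  ext j
  by_cases hj : j = i
  · subst hj; simp [sub_ne_zero.2 ha1]
  · simp [hj]

theorem exists_mem_forall_mem_ne_zero {Y : Submodule F (Fin n → F)} (hY : IsNondeg F n Y)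
    (I : Finset (Fin n)) (hI : (I.card : Cardinal) ≤ Cardinal.mk F) :
    ∃ v ∈ Y, ∀ i ∈ I, v i ≠ 0 := by
  classical
  induction I using Finset.induction_on with
  | empty => exact ⟨0, Y.zero_mem, by simp⟩
  | insert k I hk ih =>
    rw [Finset.card_insert_of_notMem hk] at hI
    have hlt : (I.card : Cardinal) < Cardinal.mk F :=
      lt_of_lt_of_le (by exact_mod_cast I.card.lt_succ_self) hI
    obtain ⟨a, haY, ha⟩ := ih hlt.le
    obtain ⟨b, hbY, hb⟩ := isNondeg_iff.1 hY k
    by_cases hak : a k = 0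
    · obtain ⟨t, ht⟩ := Cardinal.exists_notMem_of_length_lt
        (I.toList.map fun i => -b i / a i) (by simpa using hlt)
      refine ⟨b + t • a, Y.add_mem hbY (Y.smul_mem _ haY), fun i hi => ?_⟩
      rcases Finset.mem_insert.1 hi with rfl | hi
      · simpa [hak] using hb
      · intro h0
        refine ht (List.mem_map.2 ⟨i, Finset.mem_toList.2 hi, ?_⟩)
        rw [div_eq_iff (ha i hi)]
        simp only [Pi.add_apply, Pi.smul_apply, smul_eq_mul] at h0
        linear_combination -h0
    · refine ⟨a, haY, fun i hi => ?_⟩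
      rcases Finset.mem_insert.1 hi with rfl | hi
      exacts [hak, ha i hi]

end Nondegenerate

section FourSpace

variable {F : Type*} [Field F]

theorem exists_isNondeg_of_mem (hF : (3 : Cardinal) ≤ Cardinal.mk F)
    {Z Y : Submodule F (Fin 4 → F)} (hZ : finrank F Z = 1) (hY : finrank F Y = 3)
    (hYn : IsNondeg F 4 Y) (hZY : Z ≤ Y) :
    ∃ A : Submodule F (Fin 4 → F), finrank F A = 2 ∧ IsNondeg F 4 A ∧ Z ≤ A ∧ A ≤ Y := by
  classical
  obtain ⟨z, hz0, rfl⟩ := exists_ne_zero_eq_span hZ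
  obtain ⟨j, hj⟩ := Function.ne_iff.1 hz0
  suffices h : ∃ v ∈ Y, v ∉ Submodule.span F {z} ∧ ∀ i, z i = 0 → v i ≠ 0 by
    obtain ⟨v, hvY, hvz, hv⟩ := h
    refine ⟨Submodule.span F {z} ⊔ Submodule.span F {v}, ?_, isNondeg_iff.2 fun i => ?_,
      le_sup_left, sup_le hZY (by simpa using hvY)⟩
    · rw [Submodule.finrank_sup_span_singleton hvz, hZ]
    · by_cases hi : z i = 0
      · exact ⟨v, Submodule.mem_sup_right (Submodule.mem_span_singleton_self v), hv i hi⟩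
      · exact ⟨z, Submodule.mem_sup_left (Submodule.mem_span_singleton_self z), hi⟩
  by_cases hall : ∀ i, z i ≠ 0
  · obtain ⟨v, hvY, hvz⟩ := exists_mem_notMem_of_finrank_lt
      (A := Submodule.span F {z}) (B := Y) (by lia)
    exact ⟨v, hvY, hvz, fun i hi => absurd hi (hall i)⟩
  push Not at hall
  obtain ⟨i, hi⟩ := hall
  have hcard : (Finset.univ.filter fun i => z i = 0).card ≤ 3 := by
    have : (Finset.univ.filter fun i => z i = 0).card < (Finset.univ : Finset (Fin 4)).card :=
      Finset.card_lt_card (Finset.filter_ssubset.2 ⟨j, Finset.mem_univ _, hj⟩)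
    simp only [Finset.card_univ, Fintype.card_fin] at this
    lia
  obtain ⟨v, hvY, hv⟩ := exists_mem_forall_mem_ne_zero hYn _
    (le_trans (by exact_mod_cast hcard) hF)
  simp only [Finset.mem_filter, Finset.mem_univ, true_and] at hv
  refine ⟨v, hvY, fun hvz => ?_, hv⟩
  obtain ⟨c, rfl⟩ := Submodule.mem_span_singleton.1 hvz
  exact hv i hi (by simp [hi])

theorem exists_isNondeg_notMem (hF : (3 : Cardinal) ≤ Cardinal.mk F)
    {Y : Submodule F (Fin 4 → F)} (hY : finrank F Y = 3) (hYn : IsNondeg F 4 Y)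
    {z : Fin 4 → F} (hz : z ∈ Y) (hz0 : z ≠ 0) :
    ∃ A : Submodule F (Fin 4 → F), finrank F A = 2 ∧ IsNondeg F 4 A ∧ A ≤ Y ∧ z ∉ A := by
  have hZ := finrank_span_singleton (K := F) hz0
  obtain ⟨u, huY, hu⟩ := exists_mem_notMem_of_finrank_lt
      (A := Submodule.span F {z}) (B := Y) (by lia)
  have hZu := Submodule.finrank_sup_span_singleton hu
  obtain ⟨w, hwY, hw⟩ := exists_mem_notMem_of_finrank_lt
      (A := Submodule.span F {z} ⊔ Submodule.span F {u}) (B := Y) (by lia)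
  have hZuw := Submodule.finrank_sup_span_singleton hw
  have hspan : Submodule.span F {z} ⊔ Submodule.span F {u} ⊔ Submodule.span F {w} = Y :=
    Submodule.eq_of_le_of_finrank_eq (by simp [hz, huY, hwY]) (by lia)
  obtain ⟨⟨s, t⟩, hst⟩ := Cardinal.exists_notMem_of_length_lt
    (List.ofFn fun i => (-u i / z i, -w i / z i)) (by
      rw [List.length_ofFn, ← Cardinal.mul_def]
      exact lt_of_lt_of_le (b := (3 * 3 : Cardinal)) (by norm_num) (mul_le_mul' hF hF))
  set A := Submodule.span F {u + s • z} ⊔ Submodule.span F {w + t • z} with hA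
  have hu' : u + s • z ∈ A := Submodule.mem_sup_left (Submodule.mem_span_singleton_self _)
  have hw' : w + t • z ∈ A := Submodule.mem_sup_right (Submodule.mem_span_singleton_self _)
  have hAY : A ≤ Y := by
    simp only [hA, sup_le_iff, Submodule.span_singleton_le_iff_mem]
    exact ⟨Y.add_mem huY (Y.smul_mem _ hz), Y.add_mem hwY (Y.smul_mem _ hz)⟩
  have hAz : A ⊔ Submodule.span F {z} = Y := by
    refine le_antisymm (sup_le hAY (by simpa)) ?_
    have hz' : z ∈ A ⊔ Submodule.span F {z} :=
      Submodule.mem_sup_right (Submodule.mem_span_singleton_self z)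
    simp only [← hspan, sup_le_iff, Submodule.span_singleton_le_iff_mem]
    refine ⟨⟨hz', ?_⟩, ?_⟩
    · simpa using Submodule.sub_mem _ (Submodule.mem_sup_left hu') (Submodule.smul_mem _ s hz')
    · simpa using Submodule.sub_mem _ (Submodule.mem_sup_left hw') (Submodule.smul_mem _ t hz')
  have hA2 : finrank F A ≤ 2 :=
    (Submodule.finrank_add_le_finrank_add_finrank _ _).trans
      (add_le_add (finrank_span_singleton_le_one _) (finrank_span_singleton_le_one _))
  have hzA : z ∉ A := fun h => by
    rw [sup_eq_left.2 (by simpa)] at hAz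
    rw [hAz] at hA2
    lia
  refine ⟨A, ?_, isNondeg_iff.2 fun i => ?_, hAY, hzA⟩
  · have := Submodule.finrank_sup_span_singleton hzA
    rw [hAz] at this
    lia
  · by_contra! h
    have h1 := h _ hu'
    have h2 := h _ hw'
    simp only [Pi.add_apply, Pi.smul_apply, smul_eq_mul] at h1 h2
    by_cases hzi : z i = 0
    · refine hYn ⟨i, ?_⟩
      simp only [hzi, mul_zero, add_zero] at h1 h2
      rw [← hspan]
      simp [coordHyp, hzi, h1, h2]
    · refine hst ((List.mem_ofFn' _ _).2 ⟨i, ?_⟩)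
      simp only [Prod.mk.injEq, div_eq_iff hzi]
      exact ⟨by linear_combination -h1, by linear_combination -h2⟩

theorem exists_isNondeg_hyperplane (hF : (3 : Cardinal) ≤ Cardinal.mk F)
    {X : Submodule F (Fin 4 → F)} (hX : finrank F X = 2) {w : Fin 4 → F} (hw : w ∉ X) :
    ∃ Y : Submodule F (Fin 4 → F), finrank F Y = 3 ∧ IsNondeg F 4 Y ∧ X ≤ Y ∧ w ∉ Y := by
  have hXw := Submodule.finrank_sup_span_singleton hw
  obtain ⟨v, hv, hvi⟩ := exists_notMem_forall_ne_zero hF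
    (W := X ⊔ Submodule.span F {w}) (fun h => by rw [h] at hXw; simp [hX] at hXw)
  have hvX : v ∉ X := fun h => hv (Submodule.mem_sup_left h)
  refine ⟨X ⊔ Submodule.span F {v}, ?_, isNondeg_iff.2 fun i => ⟨v, ?_, hvi i⟩,
    le_sup_left, fun hwv => ?_⟩
  · rw [Submodule.finrank_sup_span_singleton hvX, hX]
  · exact Submodule.mem_sup_right (Submodule.mem_span_singleton_self v)
  · have hXv := Submodule.finrank_sup_span_singleton hvX
    have hle : X ⊔ Submodule.span F {w} ≤ X ⊔ Submodule.span F {v} :=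
      sup_le le_sup_left (by simpa using hwv)
    have heq := Submodule.eq_of_le_of_finrank_eq hle (by lia)
    exact hv (heq ▸ Submodule.mem_sup_right (Submodule.mem_span_singleton_self v))

theorem isMaxCliqueD_Tc (hF : (3 : Cardinal) ≤ Cardinal.mk F)
    {Y : Submodule F (Fin 4 → F)} (hY : finrank F Y = 3) (hYn : IsNondeg F 4 Y) :
    IsMaxCliqueD F 4 2 (Tc F 4 2 Y) := by
  refine ⟨⟨fun A hA => ⟨hA.1, hA.2.2⟩, fun A hA B hB hne =>
    ⟨hne, finrank_inf_eq_one_of_le hA.1 hB.1 hY hA.2.1 hB.2.1 hne⟩⟩, fun D hD hsub =>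
    (hsub.antisymm fun B hB => ?_).symm⟩
  obtain ⟨hB2, hBn⟩ := hD.1 B hB
  refine ⟨hB2, ?_, hBn⟩
  by_contra hBY
  have h1 := finrank_inf_eq_one_of_not_le (by simp) hB2 hY hBY
  obtain ⟨z, hz0, hz⟩ := exists_ne_zero_eq_span h1
  have hzBY : z ∈ B ⊓ Y := hz ▸ Submodule.mem_span_singleton_self z
  obtain ⟨A, hA2, hAn, hAY, hzA⟩ := exists_isNondeg_notMem hF hY hYn hzBY.2 hz0
  have hAB := hD.2 A (hsub ⟨hA2, hAY, hAn⟩) B hB fun h => hBY (h ▸ hAY)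
  have heq : A ⊓ B = B ⊓ Y := Submodule.eq_of_le_of_finrank_eq
    (le_inf inf_le_right (inf_le_left.trans hAY)) (hAB.2.trans h1.symm)
  exact hzA (heq ▸ hzBY : z ∈ A ⊓ B).1

theorem isMaxCliqueD_Sc (hF : (3 : Cardinal) ≤ Cardinal.mk F)
    {Z : Submodule F (Fin 4 → F)} (hZ : finrank F Z = 1) :
    IsMaxCliqueD F 4 2 (Sc F 4 2 Z) := by
  refine ⟨⟨fun A hA => ⟨hA.1, hA.2.2⟩, fun A hA B hB hne =>
    ⟨hne, finrank_inf_eq_one_of_ge hA.1 hB.1 hZ hA.2.1 hB.2.1 hne⟩⟩, fun D hD hsub =>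
    (hsub.antisymm fun B hB => ?_).symm⟩
  obtain ⟨hB2, hBn⟩ := hD.1 B hB
  refine ⟨hB2, ?_, hBn⟩
  obtain ⟨z, hz0, rfl⟩ := exists_ne_zero_eq_span hZ
  by_contra hzB
  rw [Submodule.span_singleton_le_iff_mem] at hzB
  have hBz := Submodule.finrank_sup_span_singleton hzB
  obtain ⟨v, hv, hvi⟩ := exists_notMem_forall_ne_zero hF
    (W := B ⊔ Submodule.span F {z}) (fun h => by rw [h] at hBz; simp [hB2] at hBz)
  have hvz : v ∉ Submodule.span F {z} := fun h => hv (Submodule.mem_sup_right h)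
  set A := Submodule.span F {z} ⊔ Submodule.span F {v}
  have hA2 : finrank F A = 2 := by rw [Submodule.finrank_sup_span_singleton hvz, hZ]
  have hzA : z ∈ A := Submodule.mem_sup_left (Submodule.mem_span_singleton_self z)
  have hvA : v ∈ A := Submodule.mem_sup_right (Submodule.mem_span_singleton_self v)
  have hAB := hD.2 A (hsub ⟨hA2, le_sup_left, isNondeg_iff.2 fun i => ⟨v, hvA, hvi i⟩⟩) B hB
    fun h => hzB (h ▸ hzA)
  have h3 := finrank_sup_eq_three hA2 hB2 hAB.2
  have heq : B ⊔ Submodule.span F {z} = A ⊔ B := Submodule.eq_of_le_of_finrank_eq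
    (sup_le le_sup_right (by simpa using Submodule.mem_sup_left hzA)) (by lia)
  exact hv (heq ▸ Submodule.mem_sup_left hvA)

theorem exists_mem_Tc_ne (hF : (3 : Cardinal) ≤ Cardinal.mk F)
    {Y : Submodule F (Fin 4 → F)} (hY : finrank F Y = 3) (hYn : IsNondeg F 4 Y) :
    ∃ A ∈ Tc F 4 2 Y, ∃ B ∈ Tc F 4 2 Y, A ≠ B := by
  have key : ∀ Z ≤ Y, Z ≠ ⊥ → ∃ A ∈ Tc F 4 2 Y, A ≠ Z := fun Z hZY hZ => by
    obtain ⟨z, hzZ, hz0⟩ := Submodule.exists_mem_ne_zero_of_ne_bot hZ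
    obtain ⟨A, hA2, hAn, hAY, hzA⟩ := exists_isNondeg_notMem hF hY hYn (hZY hzZ) hz0
    exact ⟨A, ⟨hA2, hAY, hAn⟩, fun h => hzA (h ▸ hzZ)⟩
  obtain ⟨A, hA, -⟩ := key Y le_rfl fun h => by rw [h, finrank_bot] at hY; lia
  obtain ⟨B, hB, hne⟩ := key A hA.2.1 fun h => by
    have := hA.1
    rw [h, finrank_bot] at this
    lia
  exact ⟨B, hB, A, hA, hne⟩

theorem Tc_injOn (hF : (3 : Cardinal) ≤ Cardinal.mk F)
    {Y Y' : Submodule F (Fin 4 → F)} (hY : finrank F Y = 3) (hYn : IsNondeg F 4 Y)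
    (hY' : finrank F Y' = 3) (h : Tc F 4 2 Y = Tc F 4 2 Y') : Y = Y' := by
  obtain ⟨A, hA, B, hB, hne⟩ := exists_mem_Tc_ne hF hY hYn
  have h3 := finrank_sup_eq_three hA.1 hB.1
    (finrank_inf_eq_one_of_le hA.1 hB.1 hY hA.2.1 hB.2.1 hne)
  have e1 := Submodule.eq_of_le_of_finrank_eq (sup_le hA.2.1 hB.2.1) (h3.trans hY.symm)
  rw [h] at hA hB
  exact e1.symm.trans
    (Submodule.eq_of_le_of_finrank_eq (sup_le hA.2.1 hB.2.1) (h3.trans hY'.symm))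

theorem le_of_forall_isNondeg_le (hF : (3 : Cardinal) ≤ Cardinal.mk F)
    {X W : Submodule F (Fin 4 → F)} (hX : finrank F X = 2)
    (h : ∀ Y : Submodule F (Fin 4 → F), finrank F Y = 3 → IsNondeg F 4 Y → X ≤ Y → W ≤ Y) :
    W ≤ X := fun w hw => by
  by_contra hwX
  obtain ⟨Y, hY, hYn, hXY, hwY⟩ := exists_isNondeg_hyperplane hF hX hwX
  exact hwY (h Y hY hYn hXY hw)

theorem TopsThrough_injective (hF : (3 : Cardinal) ≤ Cardinal.mk F)
    {X X' : Submodule F (Fin 4 → F)} (hX : finrank F X = 2) (hX' : finrank F X' = 2)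
    (h : TopsThrough F 4 2 X = TopsThrough F 4 2 X') : X = X' := by
  refine (Submodule.eq_of_le_of_finrank_eq (le_of_forall_isNondeg_le hF hX ?_)
    (hX'.trans hX.symm)).symm
  intro Y hY hYn hXY
  have hT : Tc F 4 2 Y ∈ TopsThrough F 4 2 X := ⟨Y, hY, hYn, hXY, rfl⟩
  rw [h] at hT
  obtain ⟨Y', hY', -, hXY', heq⟩ := hT
  exact Tc_injOn hF hY hYn hY' heq ▸ hXY'

theorem isTopD_iff (hF : (3 : Cardinal) ≤ Cardinal.mk F)
    {T : Set (Submodule F (Fin 4 → F))} : IsTopD F 4 2 T ↔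
      ∃ Y : Submodule F (Fin 4 → F), finrank F Y = 3 ∧ IsNondeg F 4 Y ∧ T = Tc F 4 2 Y := by
  refine ⟨?_, fun ⟨Y, hY, hYn, hT⟩ => ⟨⟨Y, hY, hT⟩, hT ▸ isMaxCliqueD_Tc hF hY hYn⟩⟩
  rintro ⟨⟨Y, hY, rfl⟩, -, hmax⟩
  refine ⟨Y, hY, fun hYd => ?_, rfl⟩
  have hempty : Tc F 4 2 Y = ∅ := Set.eq_empty_of_forall_notMem fun A hA =>
    (hA.2.2.mono hA.2.1) hYd
  obtain ⟨z, hz0⟩ := exists_ne (0 : Fin 4 → F)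
  obtain ⟨v, hv, hvi⟩ := exists_notMem_forall_ne_zero hF (W := Submodule.span F {z})
    fun h => by
      have := finrank_span_singleton (K := F) hz0
      rw [h, finrank_top] at this
      simp at this
  have hA : finrank F ↥(Submodule.span F {z} ⊔ Submodule.span F {v}) = 2 := by
    rw [Submodule.finrank_sup_span_singleton hv, finrank_span_singleton hz0]
  have hAn : IsNondeg F 4 (Submodule.span F {z} ⊔ Submodule.span F {v}) := isNondeg_iff.2
    fun i => ⟨v, Submodule.mem_sup_right (Submodule.mem_span_singleton_self v), hvi i⟩
  have := hmax {Submodule.span F {z} ⊔ Submodule.span F {v}}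
    ⟨by rintro _ rfl; exact ⟨hA, hAn⟩, by rintro _ rfl _ rfl h; exact absurd rfl h⟩
    (by simp [hempty])
  rw [hempty] at this
  exact Set.singleton_ne_empty _ this

theorem eq_inf_of_mem_Tc {Y Y' A : Submodule F (Fin 4 → F)} (hY : finrank F Y = 3)
    (hY' : finrank F Y' = 3) (hne : Y ≠ Y') (hA : A ∈ Tc F 4 2 Y) (hAY' : A ≤ Y') :
    A = Y ⊓ Y' :=
  Submodule.eq_of_le_of_finrank_eq (le_inf hA.2.1 hAY')
    (hA.1.trans (finrank_inf_eq_two (by simp) hY hY' hne).symm)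

theorem isCliqueDt'_TopsThrough (hF : (3 : Cardinal) ≤ Cardinal.mk F)
    {X : Submodule F (Fin 4 → F)} (hX : finrank F X = 2) (hXd : IsDeg F 4 X) :
    IsCliqueDt' F 4 2 (TopsThrough F 4 2 X) := by
  have disj : ∀ {Y Y' A : Submodule F (Fin 4 → F)}, finrank F Y = 3 → finrank F Y' = 3 →
      X ≤ Y → X ≤ Y' → Y ≠ Y' → A ∈ Tc F 4 2 Y → ¬A ≤ Y' := by
    intro Y Y' A hY hY' hXY hXY' hne hA hAY'
    have hXe : X = Y ⊓ Y' := Submodule.eq_of_le_of_finrank_eq (le_inf hXY hXY')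
      (hX.trans (finrank_inf_eq_two (by simp) hY hY' hne).symm)
    exact hA.2.2 (eq_inf_of_mem_Tc hY hY' hne hA hAY' ▸ hXe ▸ hXd)
  have adj : ∀ {Y Y' : Submodule F (Fin 4 → F)}, finrank F Y = 3 → finrank F Y' = 3 →
      IsNondeg F 4 Y' → X ≤ Y → X ≤ Y' → Y ≠ Y' →
      ∀ A ∈ Tc F 4 2 Y, ∃ B ∈ Tc F 4 2 Y', AdjK F 4 2 A B := by
    intro Y Y' hY hY' hYn' hXY hXY' hne A hA
    have hAY' := disj hY hY' hXY hXY' hne hA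
    have hZ := finrank_inf_eq_one_of_not_le (by simp) hA.1 hY' hAY'
    obtain ⟨B, hB, hBn, hZB, hBY'⟩ := exists_isNondeg_of_mem hF hZ hY' hYn' inf_le_right
    have hAB : A ≠ B := fun h => hAY' (h ▸ hBY')
    exact ⟨B, ⟨hB, hBY', hBn⟩, hAB,
      finrank_inf_eq_one_of_ge hA.1 hB hZ inf_le_left hZB hAB⟩
  refine ⟨?_, ?_⟩
  · rintro T ⟨Y, hY, hYn, -, hT⟩
    exact (isTopD_iff hF).2 ⟨Y, hY, hYn, hT⟩
  · rintro _ ⟨Y, hY, hYn, hXY, rfl⟩ _ ⟨Y', hY', hYn', hXY', rfl⟩ hT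
    have hne : Y ≠ Y' := fun h => hT (h ▸ rfl)
    exact ⟨⟨hT, adj hY hY' hYn' hXY hXY' hne, adj hY' hY hYn hXY' hXY hne.symm⟩,
      Set.eq_empty_of_forall_notMem fun A hA => disj hY hY' hXY hXY' hne hA.1 hA.2.2.1⟩

theorem isLinMC_TopsThrough (hF : (3 : Cardinal) ≤ Cardinal.mk F)
    {X : Submodule F (Fin 4 → F)} (hX : finrank F X = 2) (hXd : IsDeg F 4 X) :
    IsLinMC F (TopsThrough F 4 2 X) := by
  refine ⟨⟨isCliqueDt'_TopsThrough hF hX hXd, fun 𝔗 h𝔗 hsub =>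
    (hsub.antisymm fun T hT => ?_).symm⟩, X, hX, hXd, rfl⟩
  obtain ⟨Y, hY, hYn, rfl⟩ := (isTopD_iff hF).1 (h𝔗.1 T hT)
  refine ⟨Y, hY, hYn, ?_, rfl⟩
  by_contra hXY
  have hZ := finrank_inf_eq_one_of_not_le (by simp) hX hY hXY
  obtain ⟨A, hA, hAn, hZA, hAY⟩ := exists_isNondeg_of_mem hF hZ hY hYn inf_le_right
  have hAX : A ≠ X := fun h => hXY (h ▸ hAY)
  have hXA := finrank_sup_eq_three hA hX
    (finrank_inf_eq_one_of_ge hA hX hZ hZA inf_le_left hAX)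
  have hmem : Tc F 4 2 (A ⊔ X) ∈ 𝔗 :=
    hsub ⟨A ⊔ X, hXA, hAn.mono le_sup_left, le_sup_right, rfl⟩
  have hne : Tc F 4 2 Y ≠ Tc F 4 2 (A ⊔ X) := fun h =>
    hXY (Tc_injOn hF hY hYn hXA h ▸ le_sup_right)
  exact Set.eq_empty_iff_forall_notMem.1 (h𝔗.2 _ hT _ hmem hne).2 A
    ⟨⟨hA, hAY, hAn⟩, hA, le_sup_left, hAn⟩

theorem exists_mem_TopsThrough_iff {A X : Submodule F (Fin 4 → F)} (hA : finrank F A = 2)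
    (hAn : IsNondeg F 4 A) (hX : finrank F X = 2) (hne : A ≠ X) :
    (∃ T ∈ TopsThrough F 4 2 X, A ∈ T) ↔ finrank F ↥(A ⊓ X) = 1 := by
  constructor
  · rintro ⟨_, ⟨Y, hY, -, hXY, rfl⟩, hAT⟩
    exact finrank_inf_eq_one_of_le hA hX hY hAT.2.1 hXY hne
  · intro h
    exact ⟨Tc F 4 2 (A ⊔ X), ⟨A ⊔ X, finrank_sup_eq_three hA hX h, hAn.mono le_sup_left,
      le_sup_right, rfl⟩, hA, le_sup_left, hAn⟩

theorem exists_isStarD_iff (hF : (3 : Cardinal) ≤ Cardinal.mk F)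
    {X X' : Submodule F (Fin 4 → F)} (hX : finrank F X = 2) (hX' : finrank F X' = 2)
    (hne : X ≠ X') :
    (∃ S, IsStarD F 4 2 S ∧ (∀ T ∈ TopsThrough F 4 2 X, (S ∩ T).Nonempty) ∧
      ∀ T ∈ TopsThrough F 4 2 X', (S ∩ T).Nonempty) ↔ finrank F ↥(X ⊓ X') = 1 := by
  constructor
  · rintro ⟨_, ⟨⟨Z, hZ, rfl⟩, -⟩, h, h'⟩
    have key : ∀ {X : Submodule F (Fin 4 → F)}, finrank F X = 2 →
        (∀ T ∈ TopsThrough F 4 2 X, (Sc F 4 2 Z ∩ T).Nonempty) → Z ≤ X := fun hX h =>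
      le_of_forall_isNondeg_le hF hX fun Y hY hYn hXY => by
        obtain ⟨A, hA, hAY⟩ := h _ ⟨Y, hY, hYn, hXY, rfl⟩
        exact hA.2.1.trans hAY.2.1
    exact finrank_inf_eq_one_of_ge hX hX' hZ (key hX h) (key hX' h') hne
  · intro hZ
    have key : ∀ {W : Submodule F (Fin 4 → F)}, X ⊓ X' ≤ W →
        ∀ T ∈ TopsThrough F 4 2 W, (Sc F 4 2 (X ⊓ X') ∩ T).Nonempty := by
      rintro W hW _ ⟨Y, hY, hYn, hWY, rfl⟩
      obtain ⟨A, hA, hAn, hZA, hAY⟩ := exists_isNondeg_of_mem hF hZ hY hYn (hW.trans hWY)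
      exact ⟨A, ⟨hA, hZA, hAn⟩, hA, hAY, hAn⟩
    exact ⟨_, ⟨⟨_, hZ, rfl⟩, isMaxCliqueD_Sc hF hZ⟩, key inf_le_left, key inf_le_right⟩

end FourSpace

/-- for `|F| ≥ 3`, the map sending every non-degenerate `2`-dimensional
subspace to itself and every linear maximal clique `𝔗_X` to `X` is a graph isomorphism
from `Γ'_t` onto the Grassmann graph `Γ_2(F^4)`. -/
theorem stmt19 (F : Type*) [Field F] (hF : (3 : Cardinal) ≤ Cardinal.mk F) :
    ∃ φ : GammaT' F ≃g GrassmannGraph F 4 2,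
      (∀ A : {A : Submodule F (Fin 4 → F) // finrank F ↥A = 2 ∧ IsNondeg F 4 A},
        (φ (Sum.inl A)).1 = A.1) ∧
      (∀ (𝒳 : {𝒳 : Set (Set (Submodule F (Fin 4 → F))) // IsLinMC F 𝒳})
        (X : Submodule F (Fin 4 → F)), finrank F ↥X = 2 → IsDeg F 4 X →
          𝒳.1 = TopsThrough F 4 2 X → (φ (Sum.inr 𝒳)).1 = X) := by
  let f : {A : Submodule F (Fin 4 → F) // finrank F ↥A = 2 ∧ IsNondeg F 4 A} ⊕
      {𝒳 : Set (Set (Submodule F (Fin 4 → F))) // IsLinMC F 𝒳} →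
      {A : Submodule F (Fin 4 → F) // finrank F ↥A = 2} :=
    Sum.elim (fun A => ⟨A.1, A.2.1⟩) fun 𝒳 => ⟨𝒳.2.2.choose, 𝒳.2.2.choose_spec.1⟩
  have hdeg : ∀ 𝒳, IsDeg F 4 (f (Sum.inr 𝒳)).1 := fun 𝒳 => 𝒳.2.2.choose_spec.2.1
  have htops : ∀ 𝒳, 𝒳.1 = TopsThrough F 4 2 (f (Sum.inr 𝒳)).1 :=
    fun 𝒳 => 𝒳.2.2.choose_spec.2.2
  have hne : ∀ A 𝒳, (f (Sum.inl A)).1 ≠ (f (Sum.inr 𝒳)).1 := fun A 𝒳 h =>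
    A.2.2 (show IsDeg F 4 (f (Sum.inl A)).1 from h ▸ hdeg 𝒳)
  have hinj : Function.Injective f := by
    rintro (A | 𝒳) (B | 𝒴) h
    · exact congrArg Sum.inl (Subtype.ext (congrArg (fun X => X.1) h))
    · exact absurd (congrArg Subtype.val h) (hne A 𝒴)
    · exact absurd (congrArg Subtype.val h.symm) (hne B 𝒳)
    · exact congrArg Sum.inr (Subtype.ext (by rw [htops 𝒳, htops 𝒴, h]))
  have hinr : ∀ 𝒳 (X : Submodule F (Fin 4 → F)), finrank F X = 2 →
      𝒳.1 = TopsThrough F 4 2 X → (f (Sum.inr 𝒳)).1 = X := fun 𝒳 X hX h =>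
    TopsThrough_injective hF (f (Sum.inr 𝒳)).2 hX ((htops 𝒳).symm.trans h)
  have hsurj : Function.Surjective f := by
    rintro ⟨X, hX⟩
    by_cases hXd : IsDeg F 4 X
    · exact ⟨Sum.inr ⟨_, isLinMC_TopsThrough hF hX hXd⟩, Subtype.ext (hinr _ X hX rfl)⟩
    · exact ⟨Sum.inl ⟨X, hX, hXd⟩, rfl⟩
  have hmem : ∀ A 𝒳, finrank F ↥((f (Sum.inl A)).1 ⊓ (f (Sum.inr 𝒳)).1) = 1 ↔
      ∃ T ∈ 𝒳.1, A.1 ∈ T := fun A 𝒳 => by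
    rw [htops 𝒳]
    exact (exists_mem_TopsThrough_iff A.2.1 A.2.2 (f (Sum.inr 𝒳)).2 (hne A 𝒳)).symm
  have hmem' : ∀ A 𝒳, finrank F ↥((f (Sum.inr 𝒳)).1 ⊓ (f (Sum.inl A)).1) = 1 ↔
      ∃ T ∈ 𝒳.1, A.1 ∈ T := fun A 𝒳 => by
    rw [inf_comm]
    exact hmem A 𝒳
  have hstar : ∀ 𝒳 𝒴, 𝒳 ≠ 𝒴 → (finrank F ↥((f (Sum.inr 𝒳)).1 ⊓ (f (Sum.inr 𝒴)).1) = 1 ↔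
      ∃ S, IsStarD F 4 2 S ∧ (∀ T ∈ 𝒳.1, (S ∩ T).Nonempty) ∧
        ∀ T ∈ 𝒴.1, (S ∩ T).Nonempty) := fun 𝒳 𝒴 h => by
    rw [htops 𝒳, htops 𝒴]
    exact (exists_isStarD_iff hF (f _).2 (f _).2
      fun h' => h (Sum.inr_injective (hinj (Subtype.ext h')))).symm
  have hadj : ∀ v w, (GrassmannGraph F 4 2).Adj (f v) (f w) ↔ (GammaT' F).Adj v w := by
    intro v w
    simp only [GrassmannGraph, GammaT', SimpleGraph.fromRel_adj, hinj.ne_iff]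
    refine and_congr_right fun hvw => ?_
    rcases v with A | 𝒳 <;> rcases w with B | 𝒴
    · have hAB : A.1 ≠ B.1 := fun h => hvw (congrArg Sum.inl (Subtype.ext h))
      exact or_congr (and_iff_right hAB).symm (and_iff_right hAB.symm).symm
    · exact or_congr (hmem A 𝒴) (hmem' A 𝒴)
    · exact or_congr (hmem' B 𝒳) (hmem B 𝒳)
    · have h𝒳𝒴 : 𝒳 ≠ 𝒴 := fun h => hvw (congrArg Sum.inr h)
      exact or_congr (hstar 𝒳 𝒴 h𝒳𝒴) (hstar 𝒴 𝒳 h𝒳𝒴.symm)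
  exact ⟨⟨Equiv.ofBijective f ⟨hinj, hsurj⟩, hadj _ _⟩, fun _ => rfl,
    fun 𝒳 X hX _ h => hinr 𝒳 X hX h⟩
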